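/- Fix an integer r_0 ≥ 1 and integers p, q. If α_{p,q,r_0} is not an isomorphism, then ℰ^{p,q}_{r_0} ≠ ∅. -/

import Mathlib

open Submodule

/-- A double complex of `k`-vector spaces: `A = ⊕_{p,q ∈ ℤ} A^{p,q}` with `A^{p,q} = 0`
for `p < 0` or `q < 0`, with anticommuting differentials `d' : A^{p,q} → A^{p+1,q}` and
`d'' : A^{p,q} → A^{p,q+1}` squaring to zero. -/
structure DoubleComplex (k : Type*) [Field k] (V : Type*) [AddCommGroup V] [Module k V] where
  A : ℤ → ℤ → Submodule k V
  isInternal : DirectSum.IsInternal (fun pq : ℤ × ℤ => A pq.1 pq.2)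
  vanish : ∀ p q : ℤ, p < 0 ∨ q < 0 → A p q = ⊥
  d' : V →ₗ[k] V
  d'' : V →ₗ[k] V
  mapA_d' : ∀ p q : ℤ, (A p q).map d' ≤ A (p + 1) q
  mapA_d'' : ∀ p q : ℤ, (A p q).map d'' ≤ A p (q + 1)
  d'_d' : d' ∘ₗ d' = 0
  d''_d'' : d'' ∘ₗ d'' = 0
  anticomm : d' ∘ₗ d'' + d'' ∘ₗ d' = 0

namespace DoubleComplex

variable {k : Type*} [Field k] {V : Type*} [AddCommGroup V] [Module k V]
variable (C : DoubleComplex k V)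

/-- The total differential `d = d' + d''`. -/
def dTot : V →ₗ[k] V := C.d' + C.d''

lemma dd_apply (x : V) : C.dTot (C.dTot x) = 0 := by
  have h1 := LinearMap.ext_iff.mp C.d'_d' x
  have h2 := LinearMap.ext_iff.mp C.d''_d'' x
  have h3 := LinearMap.ext_iff.mp C.anticomm x
  simp only [LinearMap.comp_apply, LinearMap.zero_apply, LinearMap.add_apply] at h1 h2 h3
  simp only [dTot, LinearMap.add_apply, map_add]
  rw [h1, h2, zero_add, add_zero, add_comm]
  exact h3

/-- The filtration `F^p A^n = ⊕_{s ≥ p} A^{s, n-s}`. -/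
def F (p n : ℤ) : Submodule k V := ⨆ (s : ℤ) (_ : p ≤ s), C.A s (n - s)

lemma F_antitone {p p' : ℤ} (h : p ≤ p') (n : ℤ) : C.F p' n ≤ C.F p n :=
  biSup_mono fun s hs => le_trans h hs

/-- `Z^{p,q}_r = {ξ ∈ F^p A^{p+q} : dξ ∈ F^{p+r} A^{p+q+1}}`. -/
def Z (p q r : ℤ) : Submodule k V :=
  C.F p (p + q) ⊓ (C.F (p + r) (p + q + 1)).comap C.dTot

/-- `Z^{p,q}_∞ = F^p A^{p+q} ∩ ker d`. -/
def Zinf (p q : ℤ) : Submodule k V := C.F p (p + q) ⊓ LinearMap.ker C.dTot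

/-- `B^{p,q}_r = F^p A^{p+q} ∩ d(F^{p-r} A^{p+q-1})`. -/
def B (p q r : ℤ) : Submodule k V :=
  C.F p (p + q) ⊓ (C.F (p - r) (p + q - 1)).map C.dTot

/-- `B^{p,q}_∞ = F^p A^{p+q} ∩ im d`. -/
def Binf (p q : ℤ) : Submodule k V := C.F p (p + q) ⊓ LinearMap.range C.dTot

lemma B_mono (p q : ℤ) {r r' : ℤ} (h : r ≤ r') : C.B p q r ≤ C.B p q r' :=
  inf_le_inf le_rfl (Submodule.map_mono (C.F_antitone (by omega) _))

lemma Z_anti (p q : ℤ) {r r' : ℤ} (h : r' ≤ r) : C.Z p q r ≤ C.Z p q r' :=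
  inf_le_inf le_rfl (Submodule.comap_mono (C.F_antitone (by omega) _))

/-- The denominator `Z^{p+1,q-1}_{r-1} + B^{p,q}_{r-1}` of `E^{p,q}_r`. -/
def Eden (p q r : ℤ) : Submodule k V := C.Z (p + 1) (q - 1) (r - 1) ⊔ C.B p q (r - 1)

/-- `E^{p,q}_r = Z^{p,q}_r / (Z^{p+1,q-1}_{r-1} + B^{p,q}_{r-1})`. -/
abbrev E (p q r : ℤ) :=
  C.Z p q r ⧸ (C.Eden p q r).comap (C.Z p q r).subtype

/-- The common target `Z^{p,q}_r / (Z^{p+1,q-1}_{r-1} + B^{p,q}_r)` of `α_{p,q,r}` and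
`β_{p,q,r}`. -/
abbrev T (p q r : ℤ) :=
  C.Z p q r ⧸ (C.Z (p + 1) (q - 1) (r - 1) ⊔ C.B p q r).comap (C.Z p q r).subtype

/-- `β_{p,q,r} : E^{p,q}_r → Z^{p,q}_r/(Z^{p+1,q-1}_{r-1} + B^{p,q}_r)`, induced by the
identity of `Z^{p,q}_r`. -/
def beta (p q r : ℤ) : C.E p q r →ₗ[k] C.T p q r :=
  Submodule.mapQ _ _ LinearMap.id (by
    intro x hx
    simp only [Submodule.mem_comap, LinearMap.id_coe, id_eq] at hx ⊢
    exact sup_le_sup_left (C.B_mono p q (by omega)) _ hx)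

/-- `α_{p,q,r} : E^{p,q}_{r+1} → Z^{p,q}_r/(Z^{p+1,q-1}_{r-1} + B^{p,q}_r)`, induced by the
inclusion `Z^{p,q}_{r+1} ⊆ Z^{p,q}_r`. -/
def alpha (p q r : ℤ) : C.E p q (r + 1) →ₗ[k] C.T p q r :=
  Submodule.mapQ _ _ (Submodule.inclusion (C.Z_anti p q (by omega : r ≤ r + 1))) (by
    rw [← Submodule.comap_comp, Submodule.subtype_comp_inclusion]
    exact Submodule.comap_mono
      (sup_le_sup (C.Z_anti _ _ (by omega)) (C.B_mono _ _ (by omega))))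

lemma d_Z (p q r : ℤ) : ∀ x ∈ C.Z p q r, C.dTot x ∈ C.Z (p + r) (q - r + 1) r := by
  intro x hx
  rw [Z, Submodule.mem_inf] at hx ⊢
  obtain ⟨hx1, hx2⟩ := hx
  constructor
  · rw [show p + r + (q - r + 1) = p + q + 1 by ring]
    exact hx2
  · rw [Submodule.mem_comap, C.dd_apply]
    exact zero_mem _

lemma d_Eden (p q r : ℤ) : ∀ x ∈ C.Eden p q r, C.dTot x ∈ C.Eden (p + r) (q - r + 1) r := by
  intro x hx
  rw [Eden, Submodule.mem_sup] at hx
  obtain ⟨y, hy, z, hz, rfl⟩ := hx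
  rw [map_add]
  apply add_mem
  · apply Submodule.mem_sup_right
    rw [Z, Submodule.mem_inf] at hy
    obtain ⟨hy1, hy2⟩ := hy
    rw [Submodule.mem_comap] at hy2
    rw [B, Submodule.mem_inf]
    have e1 : (p + 1 + (r - 1) : ℤ) = p + r := by ring
    have e2 : (p + 1 + (q - 1) + 1 : ℤ) = p + r + (q - r + 1) := by ring
    have e3 : (p + 1 + (q - 1) : ℤ) = p + r + (q - r + 1) - 1 := by ring
    rw [e1, e2] at hy2
    rw [e3] at hy1
    refine ⟨hy2, ?_⟩
    rw [show (p + r - (r - 1) : ℤ) = p + 1 by ring]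
    exact Submodule.mem_map_of_mem hy1
  · rw [B, Submodule.mem_inf] at hz
    obtain ⟨hz1, hz2⟩ := hz
    rw [Submodule.mem_map] at hz2
    obtain ⟨w, hw, rfl⟩ := hz2
    rw [C.dd_apply]
    exact zero_mem _

/-- The restriction of the total differential to `Z^{p,q}_r → Z^{p+r,q-r+1}_r`. -/
def drAux (p q r : ℤ) : C.Z p q r →ₗ[k] C.Z (p + r) (q - r + 1) r :=
  C.dTot.restrict (C.d_Z p q r)

/-- The induced differential `d_r : E^{p,q}_r → E^{p+r,q-r+1}_r`. -/
def dr (p q r : ℤ) : C.E p q r →ₗ[k] C.E (p + r) (q - r + 1) r :=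
  Submodule.mapQ _ _ (C.drAux p q r) (by
    rw [drAux, ← Submodule.comap_comp, LinearMap.subtype_comp_restrict]
    show (C.Eden p q r).comap (C.Z p q r).subtype ≤
      (C.Eden (p + r) (q - r + 1) r).comap (C.dTot ∘ₗ (C.Z p q r).subtype)
    rw [Submodule.comap_comp]
    exact Submodule.comap_mono fun x hx => C.d_Eden p q r x hx)

/-- The set `ℰ^{p,q}_r`: for `r ≥ 1` it consists of the elements
`ξ = ξ_0 + ⋯ + ξ_{r-1}` with `ξ_i ∈ A^{p+i,q-i}` such that `dξ = d'ξ_{r-1}`,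
`d'ξ_{r-1} ∉ im d''`, and `ξ_0` is not the leading term of any `d`-closed element
(no `d`-closed `η ∈ F^p A^{p+q}` has component `ξ_0` in `A^{p,q}`, i.e. `η - ξ_0 ∈ F^{p+1}`);
and `ℰ^{p,q}_0 = B^{p,q+1}_0 \ (Z^{p+1,q}_{-1} + B^{p,q+1}_{-1})`. -/
def scrE (p q r : ℤ) : Set V :=
  if 1 ≤ r then
    {ξ | ∃ c : ℕ → V, (∀ i : ℕ, c i ∈ C.A (p + i) (q - i)) ∧
        ξ = ∑ i ∈ Finset.range r.toNat, c i ∧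
        C.dTot ξ = C.d' (c (r.toNat - 1)) ∧
        C.d' (c (r.toNat - 1)) ∉ LinearMap.range C.d'' ∧
        ¬∃ η, η ∈ C.F p (p + q) ∧ C.dTot η = 0 ∧ η - c 0 ∈ C.F (p + 1) (p + q)}
  else
    (C.B p (q + 1) 0 : Set V) \ ((C.Z (p + 1) q (-1) ⊔ C.B p (q + 1) (-1) : Submodule k V) : Set V)

/-- The double complex satisfies the `d'd''`-lemma:
`im d' ∩ ker d'' ∩ A^{p,q} = ker d' ∩ im d'' ∩ A^{p,q} = im (d'd'') ∩ A^{p,q}` for all `p, q`. -/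
def DDLemma : Prop :=
  ∀ p q : ℤ,
    LinearMap.range C.d' ⊓ LinearMap.ker C.d'' ⊓ C.A p q
        = LinearMap.ker C.d' ⊓ LinearMap.range C.d'' ⊓ C.A p q ∧
      LinearMap.range C.d' ⊓ LinearMap.ker C.d'' ⊓ C.A p q
        = LinearMap.range (C.d' ∘ₗ C.d'') ⊓ C.A p q

lemma A_le_F {p s n t : ℤ} (hs : p ≤ s) (ht : s + t = n) : C.A s t ≤ C.F p n := by
  obtain rfl : t = n - s := by omega
  exact le_biSup (fun s => C.A s (n - s)) hs

lemma dTot_mem_F {p n : ℤ} {x : V} (hx : x ∈ C.F p n) : C.dTot x ∈ C.F p (n + 1) := by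
  suffices h : C.F p n ≤ (C.F p (n + 1)).comap C.dTot from h hx
  refine iSup₂_le fun _ hs y hy => ?_
  rw [Submodule.mem_comap, dTot, LinearMap.add_apply]
  exact add_mem
    (C.A_le_F (by omega) (by omega) (C.mapA_d' _ _ (Submodule.mem_map_of_mem hy)))
    (C.A_le_F hs (by omega) (C.mapA_d'' _ _ (Submodule.mem_map_of_mem hy)))

lemma exists_sub_mem_F_add_one {p n : ℤ} {x : V} (hx : x ∈ C.F p n) :
    ∃ a ∈ C.A p (n - p), x - a ∈ C.F (p + 1) n := by
  have h : C.F p n ≤ C.A p (n - p) ⊔ C.F (p + 1) n := by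
    refine iSup₂_le fun s hs => ?_
    rcases hs.eq_or_lt with rfl | hlt
    · exact le_sup_left
    · exact le_sup_of_le_right (C.A_le_F (by omega) (by omega))
  obtain ⟨a, ha, b, hb, rfl⟩ := Submodule.mem_sup.mp (h hx)
  exact ⟨a, ha, by simpa using hb⟩

/-- Splitting off the first `m` homogeneous components of an element of `F^p A^n`. -/
lemma exists_sub_sum_mem_F (m : ℕ) {p n : ℤ} {x : V} (hx : x ∈ C.F p n) :
    ∃ c : ℕ → V, (∀ i : ℕ, c i ∈ C.A (p + i) (n - (p + i))) ∧
      x - ∑ i ∈ Finset.range m, c i ∈ C.F (p + m) n := by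
  induction m generalizing p x with
  | zero => exact ⟨0, fun _ => zero_mem _, by simpa using hx⟩
  | succ m ih =>
    obtain ⟨a, ha, hxa⟩ := C.exists_sub_mem_F_add_one hx
    obtain ⟨c, hc, hxc⟩ := ih hxa
    refine ⟨fun i => Nat.casesOn i a c, fun i => ?_, ?_⟩
    · cases i with
      | zero => simpa using ha
      | succ i => simpa [add_assoc, add_comm (i : ℤ)] using hc i
    · rw [Finset.sum_range_succ', ← sub_sub, sub_right_comm,
        show p + (m + 1 : ℕ) = p + 1 + m by push_cast; ring]
      exact hxc

lemma disjoint_biSup_A {S T : Set (ℤ × ℤ)} (hST : Disjoint S T) :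
    Disjoint (⨆ i ∈ S, C.A i.1 i.2) (⨆ i ∈ T, C.A i.1 i.2) :=
  C.isInternal.submodule_iSupIndep.disjoint_biSup_biSup hST

/-- A homogeneous element of `im d''` is the image of a homogeneous element. -/
lemma exists_homogeneous_d''_eq {a b : ℤ} {w : V} (hw : C.d'' w ∈ C.A a (b + 1)) :
    ∃ v ∈ C.A a b, C.d'' v = C.d'' w := by
  have hle : (⊤ : Submodule k V) ≤
      C.A a b ⊔ (⨆ i ∈ ({(a, b + 1)}ᶜ : Set (ℤ × ℤ)), C.A i.1 i.2).comap C.d'' := by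
    rw [← C.isInternal.submodule_iSup_eq_top]
    refine iSup_le fun ⟨s, t⟩ => ?_
    by_cases hst : (s, t) = (a, b)
    · obtain ⟨rfl, rfl⟩ := Prod.mk.inj hst
      exact le_sup_left
    · refine le_sup_of_le_right fun y hy => ?_
      refine le_biSup (fun i : ℤ × ℤ => C.A i.1 i.2) (i := (s, t + 1)) ?_
        (C.mapA_d'' _ _ (Submodule.mem_map_of_mem hy))
      simpa using hst
  obtain ⟨v, hv, u, hu, rfl⟩ := Submodule.mem_sup.mp (hle (Submodule.mem_top (x := w)))
  refine ⟨v, hv, ?_⟩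
  have hdv : C.d'' v ∈ C.A a (b + 1) := C.mapA_d'' _ _ (Submodule.mem_map_of_mem hv)
  have hdu : C.d'' u ∈ C.A a (b + 1) := by simpa using sub_mem hw hdv
  have h0 : C.d'' u = 0 := by
    refine Submodule.disjoint_def.mp (C.disjoint_biSup_A (disjoint_compl_right
      (a := ({(a, b + 1)} : Set (ℤ × ℤ))))) _ (by simpa using hdu) hu
  rw [map_add, h0, add_zero]

/-- If the components of `ξ` occupy the first `m + 1` columns from `p` on and `dξ ∈ F^{p+m+1}`,
then `dξ` is `d'` of the last component. -/
lemma dTot_sum_eq {p n : ℤ} {m : ℕ} {c : ℕ → V} (hc : ∀ i : ℕ, c i ∈ C.A (p + i) (n - (p + i)))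
    (hd : C.dTot (∑ i ∈ Finset.range (m + 1), c i) ∈ C.F (p + (m + 1)) (n + 1)) :
    C.dTot (∑ i ∈ Finset.range (m + 1), c i) = C.d' (c m) := by
  have hd' (i : ℕ) : C.d' (c i) ∈ C.A (p + i + 1) (n - (p + i)) :=
    C.mapA_d' _ _ (Submodule.mem_map_of_mem (hc i))
  have hd'' (i : ℕ) : C.d'' (c i) ∈ C.A (p + i) (n - (p + i) + 1) :=
    C.mapA_d'' _ _ (Submodule.mem_map_of_mem (hc i))
  have hdisj := C.disjoint_biSup_A (S := {i | i.1 < p + (m + 1)}) (T := {i | p + (m + 1) ≤ i.1})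
    (Set.disjoint_left.mpr fun _ hi hi' =>
      not_le_of_gt (Set.mem_ofPred.mp hi) (Set.mem_ofPred.mp hi'))
  have hlow {s t : ℤ} (hs : s < p + (m + 1)) :
      C.A s t ≤ ⨆ i ∈ {i : ℤ × ℤ | i.1 < p + (m + 1)}, C.A i.1 i.2 :=
    le_biSup (fun i : ℤ × ℤ => C.A i.1 i.2) (i := (s, t)) hs
  have hhigh : C.F (p + (m + 1)) (n + 1) ≤
      ⨆ i ∈ {i : ℤ × ℤ | p + (m + 1) ≤ i.1}, C.A i.1 i.2 :=
    iSup₂_le fun s hs => le_biSup (fun i : ℤ × ℤ => C.A i.1 i.2) (i := (s, n + 1 - s)) hs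
  rw [← sub_eq_zero]
  refine Submodule.disjoint_def.mp hdisj _ ?_
    (hhigh (sub_mem hd (C.A_le_F (by omega) (by omega) (hd' m))))
  have hsum : C.dTot (∑ i ∈ Finset.range (m + 1), c i) - C.d' (c m) =
      ∑ i ∈ Finset.range m, C.d' (c i) + ∑ i ∈ Finset.range (m + 1), C.d'' (c i) := by
    rw [dTot, LinearMap.add_apply, map_sum, map_sum, Finset.sum_range_succ (fun i => C.d' (c i))]
    abel
  rw [hsum]
  refine add_mem (sum_mem fun i hi => ?_) (sum_mem fun i hi => ?_)
  · exact hlow (by have := Finset.mem_range.mp hi; omega) (hd' i)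
  · exact hlow (by have := Finset.mem_range.mp hi; omega) (hd'' i)

lemma B_le_Z (p q r s : ℤ) : C.B p q r ≤ C.Z p q s := by
  rintro x ⟨hx, y, -, rfl⟩
  refine ⟨hx, ?_⟩
  rw [SetLike.mem_coe, Submodule.mem_comap, C.dd_apply]
  exact zero_mem _

lemma Z_inf_le_Eden (p q r : ℤ) :
    C.Z p q (r + 1) ⊓ (C.Z (p + 1) (q - 1) (r - 1) ⊔ C.B p q r) ≤ C.Eden p q (r + 1) := by
  rintro x ⟨hx, hx'⟩
  obtain ⟨z, hz, b, hb, hzb⟩ := Submodule.mem_sup.mp hx'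
  have hzZ : z ∈ C.Z p q (r + 1) := by
    rw [eq_sub_of_add_eq hzb]
    exact sub_mem hx (C.B_le_Z _ _ _ _ hb)
  rw [Eden, add_sub_cancel_right]
  refine Submodule.mem_sup.mpr ⟨z, ⟨hz.1, ?_⟩, b, hb, hzb⟩
  have hdz : C.dTot z ∈ C.F (p + (r + 1)) (p + q + 1) := hzZ.2
  rw [SetLike.mem_coe, Submodule.mem_comap, show p + 1 + r = p + (r + 1) by ring,
    show p + 1 + (q - 1) + 1 = p + q + 1 by ring]
  exact hdz

lemma mapQ_inclusion_injective {P Q D D' : Submodule k V} (hPQ : P ≤ Q)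
    (hD : D.comap P.subtype ≤ (D'.comap Q.subtype).comap (Submodule.inclusion hPQ))
    (h : P ⊓ D' ≤ D) :
    Function.Injective (Submodule.mapQ (D.comap P.subtype) (D'.comap Q.subtype)
      (Submodule.inclusion hPQ) hD) := by
  rw [← LinearMap.ker_eq_bot, Submodule.ker_mapQ, ← LinearMap.le_ker_iff_map,
    Submodule.ker_mkQ]
  exact fun x hx => h ⟨x.2, hx⟩

lemma alpha_injective (p q r : ℤ) : Function.Injective (C.alpha p q r) :=
  mapQ_inclusion_injective _ _ (C.Z_inf_le_Eden p q r)

lemma alpha_surjective_of_le {p q r : ℤ}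
    (h : C.Z p q r ≤ C.Z p q (r + 1) ⊔ C.Z (p + 1) (q - 1) (r - 1)) :
    Function.Surjective (C.alpha p q r) := by
  intro t
  obtain ⟨x, rfl⟩ := Submodule.mkQ_surjective _ t
  obtain ⟨y, hy, z, hz, hyz⟩ := Submodule.mem_sup.mp (h x.2)
  refine ⟨Submodule.Quotient.mk ⟨y, hy⟩, ?_⟩
  rw [alpha, Submodule.mapQ_apply, Submodule.mkQ_apply, Submodule.Quotient.eq,
    Submodule.mem_comap]
  refine Submodule.mem_sup_left ?_
  have : (y : V) - x = -z := by rw [← hyz]; abel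
  simpa [this] using hz

theorem statement_10 (r₀ : ℤ) (hr₀ : 1 ≤ r₀) (p q : ℤ)
    (h : ¬Function.Bijective ⇑(C.alpha p q r₀)) : C.scrE p q r₀ ≠ ∅ := by
  obtain ⟨m, rfl⟩ : ∃ m : ℕ, r₀ = m + 1 := ⟨(r₀ - 1).toNat, by omega⟩
  have hZ : ¬ C.Z p q (m + 1) ≤ C.Z p q (m + 1 + 1) ⊔ C.Z (p + 1) (q - 1) (m + 1 - 1) :=
    fun hle => h ⟨C.alpha_injective _ _ _, C.alpha_surjective_of_le hle⟩
  obtain ⟨x, hx, hxn⟩ := SetLike.not_le_iff_exists.mp hZ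
  -- An element of `Z_{r+1}` with the same leading term as `x` would contradict the choice of `x`.
  have key (y : V) (hy : y ∈ C.Z p q (m + 1 + 1)) : x - y ∉ C.F (p + 1) (p + q) := by
    intro hxy
    refine hxn (Submodule.mem_sup.mpr ⟨y, hy, x - y, ⟨?_, ?_⟩, by abel⟩)
    · rw [show p + 1 + (q - 1) = p + q by ring]
      exact hxy
    · have := (sub_mem hx (C.Z_anti p q (by omega) hy)).2
      rw [SetLike.mem_coe, Submodule.mem_comap] at this ⊢
      convert this using 2 <;> ring
  have hdx : C.dTot x ∈ C.F (p + (m + 1)) (p + q + 1) := hx.2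
  obtain ⟨c, hc, hxc⟩ := C.exists_sub_sum_mem_F (m + 1) hx.1
  push_cast at hxc
  have hdξ : C.dTot (∑ i ∈ Finset.range (m + 1), c i) ∈ C.F (p + (m + 1)) (p + q + 1) := by
    simpa using sub_mem hdx (C.dTot_mem_F hxc)
  have hξ := C.dTot_sum_eq hc hdξ
  have htoNat : ((m : ℤ) + 1).toNat = m + 1 := by omega
  have hd'c : C.d' (c m) ∈ C.A (p + (m + 1)) (q - (m + 1) + 1) := by
    have := C.mapA_d' _ _ (Submodule.mem_map_of_mem (hc m))
    convert this using 2 <;> ring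
  have hsum0 : ∑ i ∈ Finset.range (m + 1), c i - c 0 ∈ C.F (p + 1) (p + q) := by
    rw [Finset.sum_range_succ', add_sub_cancel_right]
    exact sum_mem fun i _ => C.A_le_F (by omega) (by omega) (hc (i + 1))
  have hxξ : x - ∑ i ∈ Finset.range (m + 1), c i ∈ C.F (p + 1) (p + q) :=
    C.F_antitone (by omega) _ hxc
  refine Set.Nonempty.ne_empty ⟨∑ i ∈ Finset.range (m + 1), c i, ?_⟩
  rw [scrE, if_pos hr₀]
  refine ⟨c, fun i => ?_, by rw [htoNat], ?_, ?_, ?_⟩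
  · convert hc i using 2
    ring
  · simpa [htoNat] using hξ
  · rw [htoNat, Nat.add_sub_cancel]
    rintro ⟨w, hw⟩
    obtain ⟨v, hv, hvw⟩ := C.exists_homogeneous_d''_eq (w := w) (hw ▸ hd'c)
    have hvF : v ∈ C.F (p + 1) (p + q) := C.A_le_F (by omega) (by omega) hv
    refine key (∑ i ∈ Finset.range (m + 1), c i - v) ⟨?_, ?_⟩ ?_
    · exact sub_mem (by simpa using sub_mem hx.1 (C.F_antitone (by omega : p ≤ p + 1) _ hxξ))
        (C.F_antitone (by omega : p ≤ p + 1) _ hvF)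
    · have hdv : C.dTot (∑ i ∈ Finset.range (m + 1), c i - v) = -C.d' v := by
        rw [map_sub, hξ, ← hw, ← hvw, dTot, LinearMap.add_apply]
        abel
      rw [SetLike.mem_coe, Submodule.mem_comap, hdv]
      exact neg_mem (C.A_le_F (by omega) (by omega)
        (C.mapA_d' _ _ (Submodule.mem_map_of_mem hv)))
    · rw [sub_sub_eq_add_sub, add_sub_right_comm]
      exact add_mem hxξ hvF
  · rintro ⟨η, hη, hdη, hη0⟩
    refine key η ⟨hη, ?_⟩ ?_
    · rw [SetLike.mem_coe, Submodule.mem_comap, hdη]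
      exact zero_mem _
    · have := sub_mem (add_mem hxξ hsum0) hη0
      simpa using this

end DoubleComplex
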